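/- Let ω, γ be real with γ ≥ 0, H = (ω/2)σz, L = √γ·σ₋, S = 1 (the 2×2 identity), and let αᵢ*, αⱼ be complex numbers. Define the superposition-of-coherent-states drift operator 𝒢X = 𝔏X + S†·[X,L]·αᵢ* + [L†,X]·S·αⱼ + (S†·X·S − X)·αᵢ*·αⱼ, where 𝔏X = −i[X,H] + (1/2)L†[X,L] + (1/2)[L†,X]L. Then: 𝒢σx = −ω·σy − (γ/2)·σx + √γ·σz·(αᵢ* + αⱼ), 𝒢σy = ω·σx − (γ/2)·σy − i·√γ·σz·(αᵢ* − αⱼ), and 𝒢σz = −γ·(1 + σz) − √γ·(σx − i·σy)·αᵢ* − √γ·(σx + i·σy)·αⱼ. -/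

import Mathlib

open Matrix Complex

/-- Pauli x matrix -/
noncomputable def σx : Matrix (Fin 2) (Fin 2) ℂ := !![0, 1; 1, 0]
/-- Pauli y matrix -/
noncomputable def σy : Matrix (Fin 2) (Fin 2) ℂ := !![0, -Complex.I; Complex.I, 0]
/-- Pauli z matrix -/
noncomputable def σz : Matrix (Fin 2) (Fin 2) ℂ := !![1, 0; 0, -1]
/-- lowering operator -/
noncomputable def σm : Matrix (Fin 2) (Fin 2) ℂ := !![0, 0; 1, 0]

/-- The Heisenberg-picture Lindblad generator `𝔏X = −i[X,H] + (1/2)L†[X,L] + (1/2)[L†,X]L`. -/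
noncomputable def lindblad (H L X : Matrix (Fin 2) (Fin 2) ℂ) : Matrix (Fin 2) (Fin 2) ℂ :=
  (-Complex.I) • (X * H - H * X) + (1 / 2 : ℂ) • (Lᴴ * (X * L - L * X))
    + (1 / 2 : ℂ) • ((Lᴴ * X - X * Lᴴ) * L)

/-- The superposition-of-coherent-states drift operator
`𝒢X = 𝔏X + S†[X,L]·αᵢ* + [L†,X]·S·αⱼ + (S†XS − X)·αᵢ*·αⱼ`. -/
noncomputable def coherentDrift (H L S : Matrix (Fin 2) (Fin 2) ℂ) (αist αj : ℂ)
    (X : Matrix (Fin 2) (Fin 2) ℂ) : Matrix (Fin 2) (Fin 2) ℂ :=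
  lindblad H L X + αist • (Sᴴ * (X * L - L * X)) + αj • ((Lᴴ * X - X * Lᴴ) * S)
    + (αist * αj) • (Sᴴ * X * S - X)

/-- Drift of the superposition-of-coherent-states quantum filter of the two-level atom:
`𝒢σx = −ωσy − (γ/2)σx + √γ·σz·(αᵢ* + αⱼ)`,
`𝒢σy = ωσx − (γ/2)σy − i√γ·σz·(αᵢ* − αⱼ)`,
`𝒢σz = −γ(1 + σz) − √γ(σx − iσy)αᵢ* − √γ(σx + iσy)αⱼ`. -/
theorem coherent_superposition_drift (ω γ : ℝ) (hγ : 0 ≤ γ)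
    (H L S : Matrix (Fin 2) (Fin 2) ℂ)
    (hH : H = ((ω : ℂ) / 2) • σz)
    (hL : L = (Real.sqrt γ : ℂ) • σm) (hS : S = 1)
    (αist αj : ℂ) :
    coherentDrift H L S αist αj σx
      = (-(ω : ℂ)) • σy - ((γ : ℂ) / 2) • σx
        + ((Real.sqrt γ : ℂ) * (αist + αj)) • σz ∧
    coherentDrift H L S αist αj σy
      = (ω : ℂ) • σx - ((γ : ℂ) / 2) • σy
        - (Complex.I * (Real.sqrt γ : ℂ) * (αist - αj)) • σz ∧
    coherentDrift H L S αist αj σz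
      = (-(γ : ℂ)) • (1 + σz) - ((Real.sqrt γ : ℂ) * αist) • (σx - Complex.I • σy)
        - ((Real.sqrt γ : ℂ) * αj) • (σx + Complex.I • σy) := by
  have hs : ((Real.sqrt γ : ℝ) : ℂ) ^ 2 = (γ : ℂ) := by
    exact_mod_cast Real.sq_sqrt hγ
  have hI : Complex.I ^ 2 = -1 := Complex.I_sq
  have hadj : (((Real.sqrt γ : ℝ) : ℂ) • σm)ᴴ
      = ((Real.sqrt γ : ℝ) : ℂ) • !![0, 1; 0, 0] := by
    ext i j
    fin_cases i <;> fin_cases j <;> simp [σm]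
  subst hH hL hS
  simp only [coherentDrift, lindblad, hadj, conjTranspose_one]
  generalize ((Real.sqrt γ : ℝ) : ℂ) = s at *
  refine ⟨?_, ?_, ?_⟩ <;> ext i j <;> fin_cases i <;> fin_cases j <;>
    simp [σx, σy, σz, σm] <;> grind
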